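/- arXiv:1610.09584 — 3 statements merged into one kernel-verified Lean document; each statement's English description precedes it below -/
import Mathlib

section
/- Pointwise reverse Khovanskii–Teissier inequality (Proposition 4.2 of the paper, in constant-coefficient form): let n ≥ 1 and let k, l be positive integers with k + l ≤ n. For all positive definite n×n complex Hermitian matrices H, A, W, B, the mixed discriminants satisfy D(H^{[n−k−l]}, A^{[k]}, W^{[l]}) · D(H^{[n−k−l]}, W^{[k]}, B^{[l]}) ≥ (k!·l!/(k+l)!) · D(H^{[n−k−l]}, W^{[k+l]}) · D(H^{[n−k−l]}, A^{[k]}, B^{[l]}). Equivalently, for constant-coefficient positive (1,1)-forms H, ω, α, β on ℂⁿ one has (H^{n−k−l}∧α^{k}∧ω^{l})(H^{n−k−l}∧ω^{k}∧β^{l}) ≥ (k!l!/(k+l)!)(H^{n−k−l}∧ω^{k+l})(H^{n−k−l}∧α^{k}∧β^{l}), where each top-degree wedge product is identified with its real coefficient against the standard volume form. -/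
open Matrix
open scoped ComplexOrder

/-- The mixed discriminant of `n` complex `n × n` matrices:
`D(M₁, …, Mₙ) = (1/n!) · ∑_{σ ∈ Sₙ} det (matrix whose j-th column is the j-th column of M_{σ(j)})`.
This is the unique symmetric multilinear function with `D(M, …, M) = det M`; equivalently,
`(1/n!)` times the coefficient of `t₁⋯tₙ` in `det (t₁ M₁ + ⋯ + tₙ Mₙ)`.
For Hermitian inputs the value is real, so we take the real part. -/
noncomputable def mixedDisc (n : ℕ) (M : Fin n → Matrix (Fin n) (Fin n) ℂ) : ℝ :=
  (((n.factorial : ℂ))⁻¹ *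
    ∑ σ : Equiv.Perm (Fin n), (Matrix.of fun i j => M (σ j) i j).det).re

/-- The tuple of matrices consisting of `a` copies of `X`, then `b` copies of `Y`,
then copies of `Z` in the remaining slots. -/
def blocks3 (n a b : ℕ) (X Y Z : Matrix (Fin n) (Fin n) ℂ) :
    Fin n → Matrix (Fin n) (Fin n) ℂ :=
  fun i => if (i : ℕ) < a then X else if (i : ℕ) < a + b then Y else Z

/-- The polynomial in `z` given by `z ↦ E (X + z • M, …, X + z • M)`. -/
noncomputable def linePoly {V : Type*} [AddCommGroup V] [Module ℂ V] {d : ℕ}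
    (E : MultilinearMap ℂ (fun _ : Fin d => V) ℂ) (X M : V) : Polynomial ℂ :=
  ∑ s : Finset (Fin d),
    Polynomial.monomial s.card (E (s.piecewise (fun _ => M) (fun _ => X)))

section LinePoly

variable {V : Type*} [AddCommGroup V] [Module ℂ V] {d : ℕ}

lemma eval_linePoly (E : MultilinearMap ℂ (fun _ : Fin d => V) ℂ) (X M : V) (z : ℂ) :
    (linePoly E X M).eval z = E (fun _ => X + z • M) := by
  have h : (fun _ : Fin d => X + z • M) = (fun _ => z • M) + (fun _ => X) := by
    ext; simp [add_comm]
  rw [h, E.map_add_univ, linePoly, Polynomial.eval_finsetSum]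
  refine Finset.sum_congr rfl fun s _ => ?_
  have h2 := E.map_piecewise_smul (fun _ => z) (s.piecewise (fun _ => M) (fun _ => X)) s
  have h3 : s.piecewise (fun i => z • s.piecewise (fun _ => M) (fun _ => X) i)
      (s.piecewise (fun _ => M) (fun _ => X)) =
      s.piecewise (fun _ => z • M) (fun _ : Fin d => X) := by
    ext i
    by_cases hi : i ∈ s <;> simp [hi]
  rw [h3] at h2
  rw [h2, Polynomial.eval_monomial]
  simp [mul_comm]

lemma eval_zero_linePoly (E : MultilinearMap ℂ (fun _ : Fin d => V) ℂ) (X M : V) :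
    (linePoly E X M).eval 0 = E (fun _ => X) := by
  simp [eval_linePoly]

lemma coeff_top_linePoly (E : MultilinearMap ℂ (fun _ : Fin d => V) ℂ) (X M : V) :
    (linePoly E X M).coeff d = E (fun _ => M) := by
  rw [linePoly, Polynomial.finsetSum_coeff, Finset.sum_eq_single Finset.univ]
  · simp
  · intro s _ hs
    rw [Polynomial.coeff_monomial, if_neg]
    intro h
    exact hs ((Finset.card_eq_iff_eq_univ s).1 (by simpa using h))
  · simp

/-- Symmetry of a multilinear form in all of its arguments. -/
def IsSymmForm (E : MultilinearMap ℂ (fun _ : Fin d => V) ℂ) : Prop :=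
  ∀ (σ : Equiv.Perm (Fin d)) (v : Fin d → V), E (v ∘ σ) = E v

lemma IsSymmForm.curryLeft {E : MultilinearMap ℂ (fun _ : Fin (d + 1) => V) ℂ}
    (hE : IsSymmForm E) (M : V) : IsSymmForm (E.curryLeft M) := by
  intro σ v
  rw [MultilinearMap.curryLeft_apply, MultilinearMap.curryLeft_apply,
    ← hE (Equiv.Perm.decomposeFin.symm (0, σ)) (Fin.cons M v)]
  congr 1
  ext i
  refine Fin.cases ?_ (fun j => ?_) i <;> simp

lemma derivative_linePoly_eval_zero {E : MultilinearMap ℂ (fun _ : Fin (d + 1) => V) ℂ}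
    (hE : IsSymmForm E) (X M : V) :
    (linePoly E X M).derivative.eval 0 = (d + 1) * E.curryLeft M (fun _ => X) := by
  have key : ∀ j : Fin (d + 1), E (({j} : Finset (Fin (d + 1))).piecewise
      (fun _ => M) (fun _ => X)) = E.curryLeft M (fun _ => X) := by
    intro j
    rw [MultilinearMap.curryLeft_apply, ← hE (Equiv.swap 0 j)]
    congr 1
    ext i
    refine Fin.cases ?_ (fun k => ?_) i
    · simp
    · by_cases h : k.succ = j
      · subst h
        simp [Finset.piecewise, Fin.ext_iff]
      · rw [Function.comp_apply, Equiv.swap_apply_of_ne_of_ne (Fin.succ_ne_zero k) h]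
        simp [h]
  have h1 : (linePoly E X M).derivative.eval 0 = (linePoly E X M).coeff 1 := by
    rw [← Polynomial.coeff_zero_eq_eval_zero, Polynomial.coeff_derivative]
    simp
  rw [h1, linePoly, Polynomial.finsetSum_coeff]
  simp_rw [Polynomial.coeff_monomial]
  rw [← Finset.sum_filter]
  have h2 : (Finset.univ.filter fun s : Finset (Fin (d + 1)) => s.card = 1) =
      Finset.univ.map ⟨fun j : Fin (d + 1) => ({j} : Finset (Fin (d + 1))),
        Finset.singleton_injective⟩ := by
    ext s
    simp [← Finset.card_eq_one, eq_comm]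
  rw [h2, Finset.sum_map]
  simp [key]

end LinePoly

/-- A polynomial without zeros in the closed right half-plane which is not constant
has logarithmic derivative with positive real part at `0`. -/
lemma re_derivative_div_pos {P : Polynomial ℂ} (hdeg : 0 < P.natDegree)
    (hP : ∀ z : ℂ, 0 ≤ z.re → P.eval z ≠ 0) :
    0 < (P.derivative.eval 0 / P.eval 0).re := by
  have h0 : P ≠ 0 := by rintro rfl; simp at hdeg
  rw [(IsAlgClosed.splits P).eval_derivative_div_eval_of_ne_zero (hP 0 (by simp))]
  have hre : ∀ s : Multiset ℂ, s.sum.re = (s.map Complex.re).sum := fun s => by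
    simpa using map_multiset_sum Complex.reAddGroupHom s
  rw [hre, Multiset.map_map]
  have hcard : P.roots ≠ 0 := by
    rw [← Multiset.card_pos, ← (IsAlgClosed.splits P).natDegree_eq_card_roots]
    exact hdeg
  have hpos : ∀ z ∈ P.roots, 0 < (1 / (0 - z)).re := by
    intro z hz
    have hz' : z.re < 0 := by
      by_contra! h
      exact hP z h ((Polynomial.mem_roots h0).1 hz)
    rw [one_div, Complex.inv_re]
    have : 0 < (0 - z).re := by simpa using hz'
    refine div_pos this (Complex.normSq_pos.2 ?_)
    intro h
    simp [h] at this
  obtain ⟨z, hz⟩ := Multiset.exists_mem_of_ne_zero hcard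
  obtain ⟨t, ht⟩ := Multiset.exists_cons_of_mem hz
  rw [ht, Multiset.map_cons, Multiset.sum_cons]
  refine add_pos_of_pos_of_nonneg (hpos z hz) (Multiset.sum_nonneg ?_)
  intro x hx
  obtain ⟨w, hw, rfl⟩ := Multiset.mem_map.1 hx
  exact (hpos w (ht ▸ Multiset.mem_cons_of_mem hw)).le

/-- A symmetric multilinear form in complex matrices which is real on Hermitian matrices, whose
diagonal is positive on positive definite matrices and does not vanish on matrices with positive
definite Hermitian part. -/
structure HalfPlaneStable {n d : ℕ}
    (E : MultilinearMap ℂ (fun _ : Fin d => Matrix (Fin n) (Fin n) ℂ) ℂ) : Prop where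
  symm : IsSymmForm E
  im_eq_zero : ∀ v, (∀ i, (v i).IsHermitian) → (E v).im = 0
  ne_zero : ∀ X : Matrix (Fin n) (Fin n) ℂ, (X + Xᴴ).PosDef → E (fun _ => X) ≠ 0
  re_pos : ∀ X : Matrix (Fin n) (Fin n) ℂ, X.PosDef → 0 < (E fun _ => X).re

namespace HalfPlaneStable

variable {n d : ℕ}

lemma re_curryLeft_div_pos
    {E : MultilinearMap ℂ (fun _ : Fin (d + 1) => Matrix (Fin n) (Fin n) ℂ) ℂ}
    (hE : HalfPlaneStable E) {X M : Matrix (Fin n) (Fin n) ℂ} (hX : (X + Xᴴ).PosDef)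
    (hM : M.PosDef) : 0 < (E.curryLeft M (fun _ => X) / E (fun _ => X)).re := by
  have hMM : (M + Mᴴ).PosDef := by
    rw [hM.isHermitian.eq]; exact hM.add hM
  have hdeg : 0 < (linePoly E X M).natDegree :=
    (Nat.succ_pos d).trans_le (Polynomial.le_natDegree_of_ne_zero
      (by rw [coeff_top_linePoly]; exact hE.ne_zero M hMM))
  have h := re_derivative_div_pos hdeg (fun z hz => by
    rw [eval_linePoly]
    apply hE.ne_zero
    have : X + z • M + (X + z • M)ᴴ = (X + Xᴴ) + (2 * z.re) • M := by
      rw [conjTranspose_add, conjTranspose_smul, hM.isHermitian.eq]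
      have h2 : (2 * z.re) • M = (z + star z) • M := by
        have : z + star z = ((2 * z.re : ℝ) : ℂ) := Complex.add_conj z
        rw [this]
        ext i j
        simp
      rw [h2, add_smul]
      abel
    rw [this]
    exact hX.add_posSemidef (hM.posSemidef.smul (by positivity)))
  rw [derivative_linePoly_eval_zero hE.symm, eval_zero_linePoly, mul_div_assoc] at h
  have h3 : ((d : ℂ) + 1) = ((d + 1 : ℝ) : ℂ) := by push_cast; rfl
  rw [h3, Complex.re_ofReal_mul] at h
  exact (pos_iff_pos_of_mul_pos h).1 (by positivity)

protected lemma curryLeft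
    {E : MultilinearMap ℂ (fun _ : Fin (d + 1) => Matrix (Fin n) (Fin n) ℂ) ℂ}
    (hE : HalfPlaneStable E) {M : Matrix (Fin n) (Fin n) ℂ} (hM : M.PosDef) :
    HalfPlaneStable (E.curryLeft M) where
  symm := hE.symm.curryLeft M
  im_eq_zero v hv := hE.im_eq_zero _ (Fin.cases hM.isHermitian hv)
  ne_zero X hX h := by
    simpa [h] using hE.re_curryLeft_div_pos hX hM
  re_pos X hX := by
    have h := hE.re_curryLeft_div_pos (X := X)
      (by rw [hX.isHermitian.eq]; exact hX.add hX) hM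
    have him : (E fun _ => X).im = 0 := hE.im_eq_zero _ fun _ => hX.isHermitian
    have hr := hE.re_pos X hX
    rw [show E (fun _ => X) = (((E fun _ => X).re : ℝ) : ℂ) from
      Complex.ext (by simp) (by simp [him]), Complex.div_ofReal_re] at h
    exact (div_pos_iff_of_pos_right hr).1 h

/-- The Rayleigh inequality. -/
lemma rayleigh {E : MultilinearMap ℂ (fun _ : Fin (d + 2) => Matrix (Fin n) (Fin n) ℂ) ℂ}
    (hE : HalfPlaneStable E) {A B W : Matrix (Fin n) (Fin n) ℂ}
    (hA : A.PosDef) (hB : B.PosDef) (hW : W.PosDef) :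
    (d + 1) * ((E fun _ => W).re * ((E.curryLeft A).curryLeft B fun _ => W).re) ≤
      (d + 2) * ((E.curryLeft A fun _ => W).re * (E.curryLeft B fun _ => W).re) := by
  set P := linePoly E W B with hP
  set Q := linePoly (E.curryLeft A) W B with hQ
  have hEA := hE.curryLeft hA
  have hEB := hE.curryLeft hB
  have hEAB := hEA.curryLeft hB
  have hneg : ∀ t : ℝ, 0 < t →
      (Q.eval (Complex.I * t) * star (P.eval (Complex.I * t))).im < 0 := by
    intro t ht
    have hY : (((-Complex.I) • (W + (Complex.I * t) • B)) +
        ((-Complex.I) • (W + (Complex.I * t) • B))ᴴ).PosDef := by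
      have : ((-Complex.I) • (W + (Complex.I * t) • B)) +
        ((-Complex.I) • (W + (Complex.I * t) • B))ᴴ = (2 * t) • B := by
        simp only [conjTranspose_smul, conjTranspose_add, hW.isHermitian.eq, hB.isHermitian.eq]
        ext i j
        simp
        linear_combination (-2 * t * B i j) * Complex.I_sq
      rw [this]
      exact hB.smul (by positivity)
    have h := hE.re_curryLeft_div_pos hY hA
    rw [hQ, hP, eval_linePoly, eval_linePoly]
    rw [(E.curryLeft A).map_smul_univ (fun _ => -Complex.I), E.map_smul_univ (fun _ => -Complex.I),
      Finset.prod_const, Finset.prod_const, Finset.card_univ, Finset.card_univ, Fintype.card_fin,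
      Fintype.card_fin, pow_succ _ (d + 1), smul_eq_mul, smul_eq_mul, mul_assoc,
      mul_div_mul_left _ _ (pow_ne_zero _ (neg_ne_zero.2 Complex.I_ne_zero))] at h
    set a := E.curryLeft A fun _ => W + (Complex.I * t) • B
    set b := E fun _ => W + (Complex.I * t) • B
    have hb : b ≠ 0 := by rintro hb; simp [hb] at h
    have hbpos := Complex.normSq_pos.2 hb
    have e : a * star b = Complex.normSq b * (-Complex.I * (a / (-Complex.I * b))) := by
      have : (Complex.normSq b : ℂ) = star b * b := Complex.normSq_eq_conj_mul_self
      rw [this]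
      field_simp
    rw [e, Complex.im_ofReal_mul]
    apply mul_neg_of_pos_of_neg hbpos
    simpa using h
  have hd : HasDerivAt (fun t : ℝ => (Q.eval (Complex.I * t) * star (P.eval (Complex.I * t))).im)
      ((d + 1) * ((E fun _ => W).re * ((E.curryLeft A).curryLeft B fun _ => W).re) -
      (d + 2) * ((E.curryLeft A fun _ => W).re * (E.curryLeft B fun _ => W).re)) 0 := by
    have hline : HasDerivAt (fun t : ℝ => Complex.I * (t : ℂ)) Complex.I 0 := by
      simpa using (Complex.ofRealCLM.hasDerivAt (x := (0 : ℝ))).const_mul Complex.I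
    have hp : ∀ R : Polynomial ℂ, HasDerivAt (fun t : ℝ => R.eval (Complex.I * t))
        (R.derivative.eval 0 * Complex.I) 0 := fun R => by
      have h : HasDerivAt (fun z => R.eval z) (R.derivative.eval 0)
          (Complex.I * ((0 : ℝ) : ℂ)) := by simpa using R.hasDerivAt 0
      exact h.comp (0 : ℝ) hline
    have h1 := (hp Q).mul (hp P).star
    have h2 := Complex.imCLM.hasFDerivAt.comp_hasDerivAt (0 : ℝ) h1
    refine h2.congr_deriv ?_
    have e1 := hE.im_eq_zero (fun _ => W) fun _ => hW.isHermitian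
    have e2 := hEA.im_eq_zero (fun _ => W) fun _ => hW.isHermitian
    have e3 := hEB.im_eq_zero (fun _ => W) fun _ => hW.isHermitian
    have e4 := hEAB.im_eq_zero (fun _ => W) fun _ => hW.isHermitian
    have p0 : P.eval 0 = E (fun _ => W) := eval_zero_linePoly ..
    have q0 : Q.eval 0 = E.curryLeft A (fun _ => W) := eval_zero_linePoly ..
    have p1 := derivative_linePoly_eval_zero hE.symm W B
    have q1 := derivative_linePoly_eval_zero hEA.symm W B
    rw [← hP] at p1
    rw [← hQ] at q1
    simp only [Complex.ofReal_zero, mul_zero, p0, q0, p1, q1]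
    simp [e1, e2, e3, e4, -MultilinearMap.curryLeft_apply]
    ring
  have h0 : (Q.eval (Complex.I * (0 : ℝ)) * star (P.eval (Complex.I * (0 : ℝ)))).im = 0 := by
    have e1 := hE.im_eq_zero (fun _ => W) fun _ => hW.isHermitian
    have e2 := hEA.im_eq_zero (fun _ => W) fun _ => hW.isHermitian
    rw [hP, hQ]
    simp only [Complex.ofReal_zero, mul_zero, eval_zero_linePoly]
    simp [e1, e2, -MultilinearMap.curryLeft_apply]
  have hlim := hd.tendsto_slope_zero_right
  have := le_of_tendsto hlim (by
    filter_upwards [self_mem_nhdsWithin] with t ht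
    have ht : 0 < t := ht
    simp only [zero_add, smul_eq_mul]
    rw [h0, sub_zero]
    exact mul_nonpos_of_nonneg_of_nonpos (by positivity) (hneg t ht).le)
  linarith

end HalfPlaneStable

/-- Evaluation of a multilinear form at the entries of a list, followed by copies of `X`. -/
def evalPadded {V : Type*} [AddCommGroup V] [Module ℂ V] {d : ℕ}
    (E : MultilinearMap ℂ (fun _ : Fin d => V) ℂ) (L : List V) (X : V) : ℂ :=
  E fun i => L.getD i X

section EvalPadded

variable {V : Type*} [AddCommGroup V] [Module ℂ V] {d : ℕ}

lemma evalPadded_nil (E : MultilinearMap ℂ (fun _ : Fin d => V) ℂ) (X : V) :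
    evalPadded E [] X = E fun _ => X := rfl

lemma evalPadded_cons (E : MultilinearMap ℂ (fun _ : Fin (d + 1) => V) ℂ) (M : V) (L : List V)
    (X : V) : evalPadded E (M :: L) X = evalPadded (E.curryLeft M) L X := by
  rw [evalPadded, evalPadded, MultilinearMap.curryLeft_apply]
  congr 1
  ext i
  refine Fin.cases ?_ (fun j => ?_) i <;> simp

lemma evalPadded_append_replicate (E : MultilinearMap ℂ (fun _ : Fin d => V) ℂ) (L : List V)
    (r : ℕ) (X : V) : evalPadded E (L ++ List.replicate r X) X = evalPadded E L X := by
  rw [evalPadded, evalPadded]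
  congr 1
  ext i
  grind

lemma IsSymmForm.evalPadded_perm {L L' : List V} (h : L.Perm L') :
    ∀ {d : ℕ} {E : MultilinearMap ℂ (fun _ : Fin d => V) ℂ}, IsSymmForm E → L.length ≤ d →
      ∀ X, evalPadded E L X = evalPadded E L' X := by
  induction h with
  | nil => intros; rfl
  | cons M _ ih =>
    intro d E hE hd X
    obtain _ | d := d
    · simp at hd
    rw [evalPadded_cons, evalPadded_cons]
    exact ih (hE.curryLeft M) (by simpa using hd) X
  | swap M N L =>
    intro d E hE hd X
    obtain _ | _ | d := d
    · simp at hd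
    · simp at hd
    rw [evalPadded, evalPadded, ← hE (Equiv.swap 0 1)]
    congr 1
    ext i
    refine Fin.cases ?_ (fun j => ?_) i
    · simp
    · refine Fin.cases ?_ (fun k => ?_) j
      · simp
      · rw [Function.comp_apply, Equiv.swap_apply_of_ne_of_ne (Fin.succ_ne_zero _)
          (fun h => Fin.succ_ne_zero k (Fin.succ_injective _ (h.trans Fin.succ_zero_eq_one.symm)))]
        simp
  | trans h₁ _ ih₁ ih₂ =>
    intro d E hE hd X
    rw [ih₁ hE hd X, ih₂ hE (h₁.length_eq ▸ hd) X]

end EvalPadded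

namespace HalfPlaneStable

variable {n : ℕ}

lemma evalPadded_re_pos {W : Matrix (Fin n) (Fin n) ℂ} (hW : W.PosDef)
    {L : List (Matrix (Fin n) (Fin n) ℂ)} (hL : ∀ M ∈ L, M.PosDef) :
    ∀ {d : ℕ} {E : MultilinearMap ℂ (fun _ : Fin d => Matrix (Fin n) (Fin n) ℂ) ℂ},
      HalfPlaneStable E → L.length ≤ d → 0 < (evalPadded E L W).re := by
  induction L with
  | nil => exact fun hE _ => hE.re_pos W hW
  | cons M L ih =>
    intro d E hE hd
    obtain _ | d := d
    · simp at hd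
    rw [evalPadded_cons]
    exact ih (fun N hN => hL N (List.mem_cons_of_mem _ hN))
      (hE.curryLeft (hL M List.mem_cons_self)) (by simpa using hd)

lemma rayleigh_evalPadded {A B W : Matrix (Fin n) (Fin n) ℂ}
    (hA : A.PosDef) (hB : B.PosDef) (hW : W.PosDef) (d : ℕ)
    {L : List (Matrix (Fin n) (Fin n) ℂ)} (hL : ∀ M ∈ L, M.PosDef) :
    ∀ {N : ℕ} {E : MultilinearMap ℂ (fun _ : Fin N => Matrix (Fin n) (Fin n) ℂ) ℂ},
      HalfPlaneStable E → L.length + (d + 2) = N →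
      (d + 1) * ((evalPadded E L W).re * (evalPadded E (A :: B :: L) W).re) ≤
        (d + 2) * ((evalPadded E (A :: L) W).re * (evalPadded E (B :: L) W).re) := by
  induction L with
  | nil =>
    intro N E hE hN
    obtain rfl : N = d + 2 := by simpa using hN.symm
    simpa only [evalPadded_cons, evalPadded_nil] using hE.rayleigh hA hB hW
  | cons M L ih =>
    intro N E hE hN
    obtain _ | N := N
    · simp at hN
    simp only [List.length_cons] at hN
    have h1 : (A :: B :: M :: L).Perm (M :: A :: B :: L) :=
      ((List.Perm.swap M B L).cons A).trans (List.Perm.swap M A _)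
    rw [hE.symm.evalPadded_perm h1 (by simp; omega),
      hE.symm.evalPadded_perm (List.Perm.swap M A L) (by simp; omega),
      hE.symm.evalPadded_perm (List.Perm.swap M B L) (by simp; omega)]
    simp only [evalPadded_cons _ M]
    exact ih (fun N hN => hL N (List.mem_cons_of_mem _ hN))
      (hE.curryLeft (hL M List.mem_cons_self)) (by omega)

end HalfPlaneStable

/-- A positive array whose adjacent `2 × 2` minors are nonpositive has nonpositive corner minors. -/
lemma corner_minor_of_adjacent_minors (b : ℕ → ℕ → ℝ) (m : ℕ)
    (hpos : ∀ i j, i + j ≤ m → 0 < b i j)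
    (hstep : ∀ i j, i + j + 2 ≤ m → b i j * b (i + 1) (j + 1) ≤ b (i + 1) j * b i (j + 1))
    (k l : ℕ) (hkl : k + l ≤ m) : b 0 0 * b k l ≤ b k 0 * b 0 l := by
  have hrow : ∀ i l, i + l + 1 ≤ m → b i 0 * b (i + 1) l ≤ b (i + 1) 0 * b i l := by
    intro i l
    induction l with
    | zero => intro _; exact (mul_comm _ _).le
    | succ l ih =>
      intro h
      have h1 := ih (by omega)
      have h2 := hstep i l (by omega)
      have p1 := hpos i l (by omega)
      have p2 := hpos (i + 1) l (by omega)
      have p3 := hpos i (l + 1) (by omega)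
      have p4 := hpos (i + 1) 0 (by omega)
      have p5 := hpos i 0 (by omega)
      refine le_of_mul_le_mul_right ?_ (mul_pos p1 p2)
      calc b i 0 * b (i + 1) (l + 1) * (b i l * b (i + 1) l)
          = (b i 0 * b (i + 1) l) * (b i l * b (i + 1) (l + 1)) := by ring
        _ ≤ (b (i + 1) 0 * b i l) * (b (i + 1) l * b i (l + 1)) :=
            mul_le_mul h1 h2 (mul_pos p1 (hpos _ _ (by omega))).le (mul_pos p4 p1).le
        _ = b (i + 1) 0 * b i (l + 1) * (b i l * b (i + 1) l) := by ring
  induction k with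
  | zero => exact (mul_comm _ _).le.trans (mul_comm _ _).le
  | succ k ih =>
    have h1 := ih (by omega)
    have h2 := hrow k l (by omega)
    have p1 := hpos k l (by omega)
    have p2 := hpos k 0 (by omega)
    have p3 := hpos (k + 1) 0 (by omega)
    have p4 := hpos 0 l (by omega)
    refine le_of_mul_le_mul_right ?_ (mul_pos p1 p2)
    calc b 0 0 * b (k + 1) l * (b k l * b k 0)
        = (b 0 0 * b k l) * (b k 0 * b (k + 1) l) := by ring
      _ ≤ (b k 0 * b 0 l) * (b (k + 1) 0 * b k l) :=
          mul_le_mul h1 h2 (mul_pos p2 (hpos _ _ (by omega))).le (mul_pos p2 p4).le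
      _ = b (k + 1) 0 * b 0 l * (b k l * b k 0) := by ring

/-- The reverse Khovanskii–Teissier inequality for half-plane stable forms. -/
lemma HalfPlaneStable.reverse_khovanskii_teissier {n k l : ℕ}
    {A B W : Matrix (Fin n) (Fin n) ℂ} (hA : A.PosDef) (hB : B.PosDef) (hW : W.PosDef)
    {L : List (Matrix (Fin n) (Fin n) ℂ)} (hL : ∀ M ∈ L, M.PosDef) {N : ℕ}
    {E : MultilinearMap ℂ (fun _ : Fin N => Matrix (Fin n) (Fin n) ℂ) ℂ}
    (hE : HalfPlaneStable E) (hN : k + l + L.length = N) :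
    (k.factorial * l.factorial : ℝ) / (k + l).factorial *
        ((evalPadded E L W).re *
          (evalPadded E (List.replicate k A ++ (List.replicate l B ++ L)) W).re) ≤
      (evalPadded E (List.replicate k A ++ L) W).re *
        (evalPadded E (List.replicate l B ++ L) W).re := by
  set a : ℕ → ℕ → ℝ := fun i j =>
    (evalPadded E (List.replicate i A ++ (List.replicate j B ++ L)) W).re with ha
  have hmem : ∀ i j, ∀ M ∈ List.replicate i A ++ (List.replicate j B ++ L), M.PosDef := by
    intro i j M hM
    simp only [List.mem_append, List.mem_replicate] at hM
    rcases hM with ⟨_, rfl⟩ | ⟨_, rfl⟩ | hM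
    exacts [hA, hB, hL M hM]
  have hapos : ∀ i j, i + j ≤ k + l → 0 < a i j := fun i j hij =>
    evalPadded_re_pos hW (hmem i j) hE (by simp; omega)
  have hastep : ∀ i j d, i + j + (d + 2) = k + l →
      (d + 1) * (a i j * a (i + 1) (j + 1)) ≤ (d + 2) * (a (i + 1) j * a i (j + 1)) := by
    intro i j d hd
    have h := rayleigh_evalPadded hA hB hW d (hmem i j) hE (by simp; omega)
    have h1 : (B :: (List.replicate i A ++ (List.replicate j B ++ L))).Perm
        (List.replicate i A ++ (List.replicate (j + 1) B ++ L)) := List.perm_middle.symm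
    rw [hE.symm.evalPadded_perm (h1.cons A) (by simp; omega),
      hE.symm.evalPadded_perm h1 (by simp; omega)] at h
    exact h
  have key := corner_minor_of_adjacent_minors (fun i j => a i j / (k + l - i - j).factorial)
    (k + l) (fun i j hij => div_pos (hapos i j hij) (by positivity)) (fun i j hij => by
      obtain ⟨d, hd⟩ : ∃ d, i + j + (d + 2) = k + l := ⟨k + l - i - j - 2, by omega⟩
      have h := hastep i j d hd
      rw [show k + l - i - j = d + 2 by omega, show k + l - (i + 1) - (j + 1) = d by omega,
        show k + l - (i + 1) - j = d + 1 by omega, show k + l - i - (j + 1) = d + 1 by omega]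
      rw [div_mul_div_comm, div_mul_div_comm, div_le_div_iff₀ (by positivity) (by positivity)]
      simp only [Nat.factorial_succ, Nat.cast_mul, Nat.cast_add, Nat.cast_one]
      have hf : (0 : ℝ) < (d + 1) * d.factorial * d.factorial := by positivity
      have := mul_le_mul_of_nonneg_right h hf.le
      nlinarith [this]) k l le_rfl
  simp only [Nat.sub_zero, Nat.add_sub_cancel_left, Nat.sub_self, Nat.factorial_zero,
    Nat.cast_one, div_one, Nat.add_sub_cancel] at key
  change _ * (a 0 0 * a k l) ≤ a k 0 * a 0 l
  rw [div_mul_div_comm, div_mul_eq_mul_div, div_le_div_iff₀ (by positivity) (by positivity)] at key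
  rw [div_mul_eq_mul_div, div_le_iff₀ (by positivity)]
  linarith

/-- The mixed discriminant, up to the factor `n!`, as a multilinear form. -/
noncomputable def mixedDiscForm (n : ℕ) :
    MultilinearMap ℂ (fun _ : Fin n => Matrix (Fin n) (Fin n) ℂ) ℂ :=
  ∑ σ : Equiv.Perm (Fin n),
    ((Matrix.detRowAlternating (R := ℂ) (n := Fin n)).toMultilinearMap.compLinearMap
      fun j : Fin n => LinearMap.pi fun i : Fin n => Matrix.entryLinearMap ℂ ℂ i j).domDomCongr σ

lemma mixedDiscForm_apply (n : ℕ) (M : Fin n → Matrix (Fin n) (Fin n) ℂ) :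
    mixedDiscForm n M = ∑ σ : Equiv.Perm (Fin n), (Matrix.of fun i j => M (σ j) i j).det := by
  rw [mixedDiscForm, _root_.sum_apply]
  refine Finset.sum_congr rfl fun σ _ => ?_
  rw [← Matrix.det_transpose]
  rfl

lemma mixedDiscForm_const (n : ℕ) (X : Matrix (Fin n) (Fin n) ℂ) :
    mixedDiscForm n (fun _ => X) = n.factorial * X.det := by
  rw [mixedDiscForm_apply]
  change ∑ σ : Equiv.Perm (Fin n), X.det = _
  simp [Fintype.card_perm]

lemma mixedDiscForm_transpose (n : ℕ) (M : Fin n → Matrix (Fin n) (Fin n) ℂ) :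
    mixedDiscForm n (fun i => (M i)ᵀ) = mixedDiscForm n M := by
  simp only [mixedDiscForm_apply, Matrix.det_apply, Matrix.of_apply, Matrix.transpose_apply]
  rw [Finset.sum_comm]
  conv_rhs => rw [Finset.sum_comm]
  rw [← Equiv.sum_comp (Equiv.inv (Equiv.Perm (Fin n)))]
  refine Finset.sum_congr rfl fun τ _ => ?_
  rw [← Equiv.sum_comp (Equiv.mulRight τ⁻¹)]
  refine Finset.sum_congr rfl fun σ _ => ?_
  rw [← Equiv.prod_comp τ]
  simp

lemma matrix_det_ne_zero_of_posDef_add_conjTranspose {n : ℕ} {X : Matrix (Fin n) (Fin n) ℂ}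
    (hX : (X + Xᴴ).PosDef) : X.det ≠ 0 := by
  intro h
  obtain ⟨v, hv, hXv⟩ := Matrix.exists_mulVec_eq_zero_iff.2 h
  have hpos := hX.dotProduct_mulVec_pos hv
  rw [Matrix.add_mulVec, hXv, zero_add, Matrix.dotProduct_mulVec, ← Matrix.star_mulVec, hXv] at hpos
  simp at hpos

lemma halfPlaneStable_mixedDiscForm (n : ℕ) : HalfPlaneStable (mixedDiscForm n) where
  symm τ v := by
    rw [mixedDiscForm_apply, mixedDiscForm_apply]
    exact Equiv.sum_comp (Equiv.mulLeft τ) fun σ => (Matrix.of fun i j => v (σ j) i j).det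
  im_eq_zero v hv := by
    rw [← Complex.conj_eq_iff_im]
    conv_rhs => rw [← mixedDiscForm_transpose]
    simp only [mixedDiscForm_apply, map_sum, RingHom.map_det]
    refine Finset.sum_congr rfl fun σ _ => congrArg _ ?_
    ext i j
    simpa using (hv (σ j)).apply j i
  ne_zero X hX := by
    rw [mixedDiscForm_const]
    exact mul_ne_zero (by exact_mod_cast n.factorial_ne_zero)
      (matrix_det_ne_zero_of_posDef_add_conjTranspose hX)
  re_pos X hX := by
    rw [mixedDiscForm_const, ← Complex.ofReal_natCast, Complex.re_ofReal_mul]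
    exact mul_pos (by exact_mod_cast n.factorial_pos) (Complex.pos_iff.1 hX.det_pos).1

lemma mixedDisc_eq (n : ℕ) (M : Fin n → Matrix (Fin n) (Fin n) ℂ) :
    mixedDisc n M = (n.factorial : ℝ)⁻¹ * (mixedDiscForm n M).re := by
  rw [mixedDisc, mixedDiscForm_apply, ← Complex.re_ofReal_mul]
  push_cast
  rfl

lemma mixedDiscForm_blocks3 {n a b c : ℕ} (h : a + b + c = n)
    (X Y Z W : Matrix (Fin n) (Fin n) ℂ) :
    mixedDiscForm n (blocks3 n a b X Y Z) = evalPadded (mixedDiscForm n)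
      (List.replicate b Y ++ (List.replicate c Z ++ List.replicate a X)) W := by
  have hp : (List.replicate b Y ++ (List.replicate c Z ++ List.replicate a X)).Perm
      (List.replicate a X ++ (List.replicate b Y ++ List.replicate c Z)) := by
    rw [← List.append_assoc]
    exact List.perm_append_comm
  rw [(halfPlaneStable_mixedDiscForm n).symm.evalPadded_perm hp (by simp; omega), evalPadded]
  congr 1
  ext i : 1
  have := i.2
  simp only [blocks3]
  grind

/-- Pointwise reverse Khovanskii–Teissier inequality in constant-coefficient form:
for positive definite Hermitian matrices `H, A, W, B` and positive integers `k, l` with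
`k + l ≤ n`, one has
`D(H^{[n−k−l]}, A^{[k]}, W^{[l]}) · D(H^{[n−k−l]}, W^{[k]}, B^{[l]})
  ≥ (k! l! / (k+l)!) · D(H^{[n−k−l]}, W^{[k+l]}) · D(H^{[n−k−l]}, A^{[k]}, B^{[l]})`. -/
theorem pointwise_reverse_KT (n k l : ℕ) (hn : 1 ≤ n) (hk : 0 < k) (hl : 0 < l)
    (hkl : k + l ≤ n)
    (H A W B : Matrix (Fin n) (Fin n) ℂ)
    (hH : H.PosDef) (hA : A.PosDef) (hW : W.PosDef) (hB : B.PosDef) :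
    mixedDisc n (blocks3 n (n - k - l) k H A W) *
      mixedDisc n (blocks3 n (n - k - l) k H W B) ≥
    ((k.factorial * l.factorial : ℝ) / (k + l).factorial) *
      (mixedDisc n (blocks3 n (n - k - l) (k + l) H W W) *
        mixedDisc n (blocks3 n (n - k - l) k H A B)) := by
  set r := n - k - l with hr
  have hsum : r + k + l = n := by omega
  have hE := halfPlaneStable_mixedDiscForm n
  have hL : ∀ M ∈ List.replicate r H, M.PosDef := fun M hM => by
    rw [(List.mem_replicate.1 hM).2]; exact hH
  have key := hE.reverse_khovanskii_teissier (k := k) (l := l) hA hB hW hL (by simp; omega)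
  have hpad : ∀ {s : ℕ} (_ : s + r ≤ n) (L : List (Matrix (Fin n) (Fin n) ℂ)),
      L.length + s ≤ n → evalPadded (mixedDiscForm n) (List.replicate s W ++ L) W =
        evalPadded (mixedDiscForm n) L W := fun _ L hs => by
    rw [hE.symm.evalPadded_perm List.perm_append_comm (by simp; omega),
      evalPadded_append_replicate]
  have e1 : mixedDiscForm n (blocks3 n r k H A W) =
      evalPadded (mixedDiscForm n) (List.replicate k A ++ List.replicate r H) W := by
    rw [mixedDiscForm_blocks3 hsum H A W W, hE.symm.evalPadded_perm
      (List.perm_append_comm.append_left _) (by simp; omega), ← List.append_assoc,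
      evalPadded_append_replicate]
  have e2 : mixedDiscForm n (blocks3 n r k H W B) =
      evalPadded (mixedDiscForm n) (List.replicate l B ++ List.replicate r H) W := by
    rw [mixedDiscForm_blocks3 hsum H W B W, hpad (by omega) _ (by simp; omega)]
  have e3 : mixedDiscForm n (blocks3 n r (k + l) H W W) =
      evalPadded (mixedDiscForm n) (List.replicate r H) W := by
    rw [mixedDiscForm_blocks3 (c := 0) (by omega) H W W W, hpad (by omega) _ (by simp; omega)]
    rfl
  rw [mixedDisc_eq, mixedDisc_eq, mixedDisc_eq, mixedDisc_eq, e1, e2, e3,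
    mixedDiscForm_blocks3 hsum H A B W, ge_iff_le]
  have hc : (0 : ℝ) ≤ (n.factorial : ℝ)⁻¹ * (n.factorial : ℝ)⁻¹ := by positivity
  have := mul_le_mul_of_nonneg_left key hc
  linarith
end

section
/- Constant-coefficient (pointwise) form of the reverse Khovanskii–Teissier inequality (Lemma 2.4 of the paper, whose pointwise case is the (k,l) = (1, n−1) instance of the paper's Proposition 4.2): let n ≥ 1. For all positive definite n×n complex Hermitian matrices A and B, and every positive semidefinite n×n complex Hermitian matrix N, the mixed discriminants satisfy n · D(N, A^{[n−1]}) · D(A, B^{[n−1]}) ≥ det(A) · D(N, B^{[n−1]}). In form language on ℂⁿ: for constant-coefficient positive (1,1)-forms α, β and a constant-coefficient nonnegative (1,1)-form N, one has n(N∧α^{n−1})(α∧β^{n−1}) ≥ αⁿ·(N∧β^{n−1}). -/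
open Matrix
open scoped ComplexOrder

/-- The sum over all permutations of a function of the image of `0`. -/
theorem sum_perm_apply_zero {R : Type*} [Semiring R] (m : ℕ) (f : Fin (m + 1) → R) :
    ∑ σ : Equiv.Perm (Fin (m + 1)), f (σ 0) = (m.factorial : R) * ∑ j, f j := by
  rw [← Equiv.sum_comp Equiv.Perm.decomposeFin.symm, Fintype.sum_prod_type, Finset.mul_sum]
  simp [Fintype.card_perm]

/-- The trace of `adj(B) * N` as a sum of determinants with one column of `B` replaced. -/
theorem trace_adjugate_mul {ι R : Type*} [Fintype ι] [DecidableEq ι] [CommRing R]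
    (B N : Matrix ι ι R) :
    (B.adjugate * N).trace = ∑ j, (B.updateCol j fun i => N i j).det := by
  refine Finset.sum_congr rfl fun j _ => ?_
  rw [← cramer_apply, cramer_eq_adjugate_mulVec]
  rfl

theorem mixedDisc_const (n : ℕ) (A : Matrix (Fin n) (Fin n) ℂ) :
    mixedDisc n (fun _ => A) = A.det.re := by
  have h : (n.factorial : ℂ) ≠ 0 := by exact_mod_cast n.factorial_ne_zero
  have hA : (Matrix.of fun i j => A i j) = A := rfl
  simp [mixedDisc, hA, Fintype.card_perm, h]

/-- `n · D(N, B, …, B) = tr (adj(B) N)`. -/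
theorem mixedDisc_blocks3_one (n : ℕ) (hn : 1 ≤ n) (N B : Matrix (Fin n) (Fin n) ℂ) :
    (n : ℝ) * mixedDisc n (blocks3 n 1 (n - 1) N B B) = (B.adjugate * N).trace.re := by
  obtain ⟨m, rfl⟩ : ∃ m, n = m + 1 := ⟨n - 1, by omega⟩
  have key : ∀ σ : Equiv.Perm (Fin (m + 1)),
      (Matrix.of fun i j => blocks3 (m + 1) 1 (m + 1 - 1) N B B (σ⁻¹ j) i j) =
        B.updateCol (σ 0) fun i => N i (σ 0) := by
    intro σ
    ext i j
    by_cases hj : j = σ 0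
    · subst hj
      simp [blocks3]
    · have h0 : σ⁻¹ j ≠ 0 := fun h => hj (by rw [← h]; simp)
      have h1 : ¬ ((σ⁻¹ j : Fin (m + 1)) : ℕ) < 1 := by
        intro h
        exact h0 (Fin.ext (by simpa using h))
      simp only [of_apply, blocks3, if_neg h1, updateCol_ne hj, ite_self]
  unfold mixedDisc
  rw [← Equiv.sum_comp (Equiv.inv (Equiv.Perm (Fin (m + 1))))]
  simp only [Equiv.inv_apply, key]
  rw [sum_perm_apply_zero m fun j => (B.updateCol j fun i => N i j).det,
    ← trace_adjugate_mul, ← Complex.re_ofReal_mul]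
  congr 1
  have h : (m.factorial : ℂ) ≠ 0 := by exact_mod_cast m.factorial_ne_zero
  have h' : ((m : ℂ) + 1) ≠ 0 := by exact_mod_cast m.succ_ne_zero
  rw [Nat.factorial_succ]
  push_cast
  field_simp

open scoped MatrixOrder Matrix.Norms.L2Operator in
theorem Matrix.PosSemidef.exists_eq_conjTranspose_mul_self {n : Type*} [Fintype n]
    [DecidableEq n] {A : Matrix n n ℂ} (hA : A.PosSemidef) : ∃ C : Matrix n n ℂ, A = Cᴴ * C :=
  CStarAlgebra.nonneg_iff_eq_star_mul_self.mp hA.nonneg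

section Frobenius

attribute [local instance] Matrix.frobeniusNormedAddCommGroup

theorem re_trace_conjTranspose_mul_self {m n : Type*} [Fintype m] [Fintype n]
    (X : Matrix m n ℂ) : (Xᴴ * X).trace.re = ‖X‖ ^ 2 := by
  rw [frobenius_norm_def, ← Real.sqrt_eq_rpow, Real.sq_sqrt (by positivity), Finset.sum_comm]
  simp [trace, mul_apply, ← Complex.normSq_eq_conj_mul_self, Complex.normSq_eq_norm_sq]
  norm_cast

theorem Matrix.PosSemidef.re_trace_mul_le {n : Type*} [Fintype n] [DecidableEq n]
    {P Q : Matrix n n ℂ} (hP : P.PosSemidef) (hQ : Q.PosSemidef) :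
    (P * Q).trace.re ≤ P.trace.re * Q.trace.re := by
  obtain ⟨X, rfl⟩ := hP.exists_eq_conjTranspose_mul_self
  obtain ⟨Y, rfl⟩ := hQ.exists_eq_conjTranspose_mul_self
  have h : (Xᴴ * X * (Yᴴ * Y)).trace = ((X * Yᴴ)ᴴ * (X * Yᴴ)).trace := by
    rw [conjTranspose_mul, conjTranspose_conjTranspose, ← Matrix.mul_assoc, trace_mul_comm]
    simp only [Matrix.mul_assoc]
  rw [h]
  simp only [re_trace_conjTranspose_mul_self, ← mul_pow]
  gcongr
  exact (frobenius_norm_mul X Yᴴ).trans_eq (by rw [frobenius_norm_conjTranspose])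

end Frobenius

/-- For positive semidefinite `N`, `M` and positive definite `A`,
`tr (M N) ≤ tr (A⁻¹ N) tr (M A)`. -/
theorem Matrix.PosDef.re_trace_mul_le {n : Type*} [Fintype n] [DecidableEq n]
    {A M N : Matrix n n ℂ} (hA : A.PosDef) (hM : M.PosSemidef) (hN : N.PosSemidef) :
    (M * N).trace.re ≤ (A⁻¹ * N).trace.re * (M * A).trace.re := by
  obtain ⟨C, rfl⟩ := hA.posSemidef.exists_eq_conjTranspose_mul_self
  have hC : IsUnit C.det := by
    have := hA.det_pos.ne'
    rw [det_mul] at this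
    exact (right_ne_zero_of_mul this).isUnit
  have h := (hN.conjTranspose_mul_mul_same C⁻¹).re_trace_mul_le
    (hM.mul_mul_conjTranspose_same C)
  have h1 : (C⁻¹ᴴ * N * C⁻¹ * (C * M * Cᴴ)).trace = (M * N).trace := by
    rw [trace_mul_comm, conjTranspose_nonsing_inv]
    have hC' : IsUnit Cᴴ.det := by rw [det_conjTranspose]; exact hC.star
    calc (C * M * Cᴴ * (Cᴴ⁻¹ * N * C⁻¹)).trace
        = (C * (M * (Cᴴ * Cᴴ⁻¹) * N * C⁻¹)).trace := by simp only [Matrix.mul_assoc]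
      _ = (M * N).trace := by
        rw [mul_nonsing_inv _ hC', trace_mul_comm, Matrix.mul_assoc _ C⁻¹,
          nonsing_inv_mul _ hC, Matrix.mul_one, Matrix.mul_one]
  have h2 : (C⁻¹ᴴ * N * C⁻¹).trace = ((Cᴴ * C)⁻¹ * N).trace := by
    rw [trace_mul_comm, mul_inv_rev, conjTranspose_nonsing_inv, Matrix.mul_assoc]
  have h3 : (C * M * Cᴴ).trace = (M * (Cᴴ * C)).trace := by
    rw [Matrix.mul_assoc, trace_mul_comm, Matrix.mul_assoc]
  rwa [h1, h2, h3] at h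

/-- Constant-coefficient form of the reverse Khovanskii–Teissier inequality:
for positive definite Hermitian matrices `A, B` and a positive semidefinite Hermitian
matrix `N`, one has `n · D(N, A^{[n−1]}) · D(A, B^{[n−1]}) ≥ det A · D(N, B^{[n−1]})`.
Here `det A = D(A, …, A) = mixedDisc n (fun _ => A)`. -/
theorem pointwise_reverse_KT_nef (n : ℕ) (hn : 1 ≤ n)
    (A B N : Matrix (Fin n) (Fin n) ℂ)
    (hA : A.PosDef) (hB : B.PosDef) (hN : N.PosSemidef) :
    (n : ℝ) * mixedDisc n (blocks3 n 1 (n - 1) N A A) *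
      mixedDisc n (blocks3 n 1 (n - 1) A B B) ≥
    mixedDisc n (fun _ => A) * mixedDisc n (blocks3 n 1 (n - 1) N B B) := by
  have adj : ∀ {X : Matrix (Fin n) (Fin n) ℂ} (Y : Matrix (Fin n) (Fin n) ℂ), X.PosDef →
      (X.adjugate * Y).trace.re = X.det.re * (X⁻¹ * Y).trace.re := by
    intro X Y hX
    have hu : X.det ≠ 0 := hX.det_pos.ne'
    have him : X.det.im = 0 := (Complex.pos_iff.mp hX.det_pos).2.symm
    have : X.adjugate = X.det • X⁻¹ := by
      rw [inv_def, smul_smul, Ring.mul_inverse_cancel _ hu.isUnit, one_smul]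
    rw [this, Matrix.smul_mul, trace_smul, smul_eq_mul, Complex.mul_re, him]
    ring
  have hn' : (0 : ℝ) < n := by exact_mod_cast hn
  have hNA := mixedDisc_blocks3_one n hn N A
  have hAB := mixedDisc_blocks3_one n hn A B
  have hNB := mixedDisc_blocks3_one n hn N B
  rw [adj _ hA] at hNA
  rw [adj _ hB] at hAB hNB
  have hdA : 0 < A.det.re := (Complex.pos_iff.mp hA.det_pos).1
  have hdB : 0 < B.det.re := (Complex.pos_iff.mp hB.det_pos).1
  have key := hA.re_trace_mul_le hB.inv.posSemidef hN
  rw [mixedDisc_const, ge_iff_le]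
  refine le_of_mul_le_mul_left ?_ hn'
  calc (n : ℝ) * (A.det.re * mixedDisc n (blocks3 n 1 (n - 1) N B B))
      = A.det.re * B.det.re * (B⁻¹ * N).trace.re := by
        rw [mul_left_comm, hNB, mul_assoc]
    _ ≤ A.det.re * B.det.re * ((A⁻¹ * N).trace.re * (B⁻¹ * A).trace.re) := by gcongr
    _ = _ := by
        rw [hNA]
        linear_combination (-(A.det.re * (A⁻¹ * N).trace.re)) * hAB
end

section
/- Constant-coefficient (pointwise) form of the restricted reverse Khovanskii–Teissier inequality (Lemma 2.5 of the paper, whose pointwise case is the instance H = ω, (k,l) = (n−2, 1) of the paper's Proposition 4.2): let n ≥ 2. For all positive definite n×n complex Hermitian matrices W, A, B, the mixed discriminants satisfy (n−1) · D(W^{[2]}, A^{[n−2]}) · D(W^{[n−1]}, B) ≥ det(W) · D(W, A^{[n−2]}, B). In form language on ℂⁿ: for constant-coefficient positive (1,1)-forms ω, α, β, one has (n−1)(ω²∧α^{n−2})(ω^{n−1}∧β) ≥ ωⁿ·(ω∧α^{n−2}∧β). -/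
open Matrix
open scoped ComplexOrder

open Equiv Finset

section MixedSum

variable {ι R : Type*} [Fintype ι] [DecidableEq ι] [CommRing R]

/-- The unnormalized mixed discriminant of a family of square matrices. -/
def mixedSum (M : ι → Matrix ι ι R) : R :=
  ∑ σ : Perm ι, (Matrix.of fun i j => M (σ j) i j).det

theorem mixedSum_mul_left (C : Matrix ι ι R) (M : ι → Matrix ι ι R) :
    mixedSum (fun k => C * M k) = C.det * mixedSum M := by
  simp only [mixedSum, mul_sum, ← det_mul]
  rfl

theorem mixedSum_transpose (M : ι → Matrix ι ι R) :
    mixedSum (fun k => (M k)ᵀ) = mixedSum M := by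
  simp only [mixedSum, det_apply, of_apply, transpose_apply]
  refine sum_comm.trans (Eq.trans ?_ sum_comm)
  rw [← Equiv.sum_comp (Equiv.inv (Perm ι))]
  refine sum_congr rfl fun π _ => ?_
  rw [← Equiv.sum_comp (Equiv.mulRight π⁻¹)]
  refine sum_congr rfl fun σ _ => ?_
  rw [← Equiv.prod_comp π]
  simp

theorem mixedSum_mul_right (M : ι → Matrix ι ι R) (C : Matrix ι ι R) :
    mixedSum (fun k => M k * C) = mixedSum M * C.det := by
  rw [← mixedSum_transpose]
  simp only [transpose_mul]
  rw [mixedSum_mul_left, mixedSum_transpose, det_transpose, mul_comm]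

/-- If all matrices but one are diagonal, only the diagonal entries contribute. -/
theorem mixedSum_eq_permanent (M : ι → Matrix ι ι R) (k₀ : ι)
    (h : ∀ k ≠ k₀, (M k).IsDiag) :
    mixedSum M = (Matrix.of fun k j => M k j j).permanent := by
  unfold mixedSum permanent
  refine sum_congr rfl fun σ _ => ?_
  rw [det_apply, sum_eq_single_of_mem 1 (mem_univ _)]
  · simp
  · intro π _ hπ
    obtain ⟨x, hx, hxk⟩ : ∃ x, π x ≠ x ∧ σ x ≠ k₀ := by
      obtain ⟨x, hx⟩ : ∃ x, π x ≠ x := by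
        by_contra! hc
        exact hπ (Equiv.ext hc)
      by_cases hk : σ x = k₀
      · refine ⟨π x, fun hc => hx (π.injective hc), fun hc => hx (σ.injective ?_)⟩
        rw [hc, hk]
      · exact ⟨x, hx, hk⟩
    have h_zero : ∏ i, (Matrix.of fun i j => M (σ j) i j) (π i) i = 0 :=
      prod_eq_zero (mem_univ x) (h _ hxk hx)
    rw [h_zero, smul_zero]

end MixedSum

section Permanent

variable {ι : Type*} [Fintype ι] [DecidableEq ι]

theorem card_mul_sum_perm_apply (b : ι → ℝ) (q : ι) :
    (Fintype.card ι : ℝ) * ∑ σ : Perm ι, b (σ q) = (Fintype.card ι).factorial * ∑ i, b i := by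
  have hk (k : ι) : ∑ σ : Perm ι, b (σ k) = ∑ σ : Perm ι, b (σ q) := by
    rw [← Equiv.sum_comp (Equiv.mulRight (swap k q))]
    simp
  calc (Fintype.card ι : ℝ) * ∑ σ : Perm ι, b (σ q)
      = ∑ k, ∑ σ : Perm ι, b (σ k) := by simp [hk]
    _ = ∑ σ : Perm ι, ∑ k, b (σ k) := sum_comm
    _ = (Fintype.card ι).factorial * ∑ i, b i := by
        simp [Equiv.sum_comp, Fintype.card_perm]

theorem two_mul_permanent_le (a b : ι → ℝ) (ha : ∀ i, 0 ≤ a i) (hb : ∀ i, 0 ≤ b i)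
    {p q : ι} (hpq : p ≠ q) :
    2 * (Matrix.of fun k j => if k = p then 1 else if k = q then b j else a j).permanent ≤
      (Matrix.of fun k j => if k = p then 1 else if k = q then 1 else a j).permanent *
        ∑ i, b i := by
  set f : Perm ι → ℝ := fun σ => ∏ k, if k = p then 1 else if k = q then 1 else a (σ k) with hf
  have hf_nonneg (σ : Perm ι) : 0 ≤ f σ :=
    prod_nonneg fun k _ => by split_ifs <;> first | exact zero_le_one | exact ha _
  have hf_swap (σ : Perm ι) : f (σ * swap p q) = f σ := by
    refine prod_congr rfl fun k _ => ?_
    split_ifs with h₁ h₂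
    · rfl
    · rfl
    · rw [Perm.mul_apply, swap_apply_of_ne_of_ne h₁ h₂]
  have h_left : (Matrix.of fun k j => if k = p then 1 else if k = q then b j else a j).permanent =
      ∑ σ, f σ * b (σ q) := by
    rw [← permanent_transpose]
    refine sum_congr rfl fun σ _ => ?_
    rw [← prod_erase_mul _ _ (mem_univ q), hf]
    dsimp only
    rw [← prod_erase_mul _ _ (mem_univ q)]
    simp only [transpose_apply, of_apply, hpq.symm, if_true, if_false, mul_one]
    congr 1
    refine prod_congr rfl fun k hk => ?_
    simp [ne_of_mem_erase hk]
  have h_right : (Matrix.of fun k j => if k = p then 1 else if k = q then 1 else a j).permanent =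
      ∑ σ, f σ := by
    rw [← permanent_transpose]
    rfl
  have h_symm : ∑ σ, f σ * b (σ q) = ∑ σ, f σ * b (σ p) := by
    rw [← Equiv.sum_comp (Equiv.mulRight (swap p q))]
    simp [hf_swap]
  rw [h_left, h_right, two_mul]
  nth_rewrite 1 [h_symm]
  rw [← sum_add_distrib, sum_mul]
  refine sum_le_sum fun σ _ => ?_
  rw [← mul_add]
  refine mul_le_mul_of_nonneg_left ?_ (hf_nonneg σ)
  rw [← sum_pair (fun h => hpq (σ.injective h))]
  exact sum_le_sum_of_subset_of_nonneg (subset_univ _) fun i _ _ => hb i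

end Permanent

open scoped MatrixOrder in
/-- A positive definite and a positive semidefinite matrix are simultaneously diagonalized by a
congruence. -/
theorem Matrix.PosDef.exists_simultaneous_diagonalization {ι : Type*} [Fintype ι]
    [DecidableEq ι] {W A : Matrix ι ι ℂ} (hW : W.PosDef) (hA : A.PosSemidef) :
    ∃ (C : Matrix ι ι ℂ) (a : ι → ℝ), IsUnit C ∧ (∀ i, 0 ≤ a i) ∧ W = C * Cᴴ ∧
      A = C * diagonal (fun i => (a i : ℂ)) * Cᴴ := by
  obtain ⟨Y, hY, rfl⟩ :=
    CStarAlgebra.isStrictlyPositive_iff_eq_star_mul_self.mp hW.isStrictlyPositive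
  have hYd := (isUnit_iff_isUnit_det _).mp hY
  have hYHd : IsUnit Yᴴ.det := by rw [det_conjTranspose]; exact hYd.star
  have hH := hA.conjTranspose_mul_mul_same Y⁻¹
  let U : Matrix ι ι ℂ := hH.isHermitian.eigenvectorUnitary
  have hUU : U * Uᴴ = 1 := Unitary.coe_mul_star_self hH.isHermitian.eigenvectorUnitary
  have hspec : Y⁻¹ᴴ * A * Y⁻¹ =
      U * diagonal (fun i => (hH.isHermitian.eigenvalues i : ℂ)) * Uᴴ := by
    conv_lhs => rw [hH.isHermitian.spectral_theorem]
    rfl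
  refine ⟨Yᴴ * U, hH.isHermitian.eigenvalues, ?_, hH.eigenvalues_nonneg, ?_, ?_⟩
  · exact hY.star.mul (IsUnit.of_mul_eq_one _ hUU)
  · rw [conjTranspose_mul, conjTranspose_conjTranspose, Matrix.mul_assoc, ← Matrix.mul_assoc U,
      hUU, Matrix.one_mul, star_eq_conjTranspose]
  · calc A = Yᴴ * (Y⁻¹ᴴ * A * Y⁻¹) * Y := by
          rw [conjTranspose_nonsing_inv, Matrix.mul_assoc (Yᴴ⁻¹),
            mul_nonsing_inv_cancel_left _ _ hYHd, nonsing_inv_mul_cancel_right _ _ hYd]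
      _ = Yᴴ * (U * diagonal (fun i => (hH.isHermitian.eigenvalues i : ℂ)) * Uᴴ) * Y := by
          rw [← hspec]
      _ = _ := by
          simp only [conjTranspose_mul, conjTranspose_conjTranspose, Matrix.mul_assoc]

/-- The mixed discriminant of a family congruent to one with at most one non-diagonal member. -/
theorem mixedDisc_congruence {n : ℕ} (C : Matrix (Fin n) (Fin n) ℂ)
    (M N : Fin n → Matrix (Fin n) (Fin n) ℂ) (d : Matrix (Fin n) (Fin n) ℝ) (k₀ : Fin n)
    (hM : ∀ k, M k = C * N k * Cᴴ) (hN : ∀ k ≠ k₀, (N k).IsDiag)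
    (hd : ∀ k j, N k j j = d k j) :
    mixedDisc n M = (n.factorial : ℝ)⁻¹ * Complex.normSq C.det * d.permanent := by
  obtain rfl : M = fun k => C * N k * Cᴴ := funext hM
  have key : ∑ σ : Perm (Fin n), (Matrix.of fun i j => (C * N (σ j) * Cᴴ) i j).det =
      Complex.normSq C.det * (d.permanent : ℂ) := by
    change mixedSum (fun k => C * N k * Cᴴ) = _
    rw [mixedSum_mul_right, mixedSum_mul_left, mixedSum_eq_permanent N k₀ hN, det_conjTranspose,
      Complex.normSq_eq_conj_mul_self, starRingEnd_apply]
    simp only [hd, permanent, of_apply, Complex.ofReal_sum, Complex.ofReal_prod]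
    ring
  rw [mixedDisc, key, mul_assoc, ← Complex.ofReal_natCast, ← Complex.ofReal_inv,
    ← Complex.ofReal_mul, ← Complex.ofReal_mul, Complex.ofReal_re]

/-- Constant-coefficient form of the restricted reverse Khovanskii–Teissier inequality:
for positive definite Hermitian matrices `W, A, B` and `n ≥ 2`, one has
`(n−1) · D(W^{[2]}, A^{[n−2]}) · D(W^{[n−1]}, B) ≥ det W · D(W, A^{[n−2]}, B)`.
Here `det W = D(W, …, W) = mixedDisc n (fun _ => W)`. -/
theorem pointwise_restricted_reverse_KT (n : ℕ) (hn : 2 ≤ n)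
    (W A B : Matrix (Fin n) (Fin n) ℂ)
    (hW : W.PosDef) (hA : A.PosDef) (hB : B.PosDef) :
    ((n : ℝ) - 1) * mixedDisc n (blocks3 n 2 (n - 2) W A A) *
      mixedDisc n (blocks3 n (n - 1) 1 W B B) ≥
    mixedDisc n (fun _ => W) * mixedDisc n (blocks3 n 1 (n - 2) W A B) := by
  obtain ⟨C, a, hC, ha, hWC, hAC⟩ := hW.exists_simultaneous_diagonalization hA.posSemidef
  have hCd := (isUnit_iff_isUnit_det _).mp hC
  have hCHd : IsUnit Cᴴ.det := by rw [det_conjTranspose]; exact hCd.star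
  set D : Matrix (Fin n) (Fin n) ℂ := diagonal fun i => (a i : ℂ) with hD
  set E : Matrix (Fin n) (Fin n) ℂ := C⁻¹ * B * C⁻¹ᴴ with hE
  have hE_psd : E.PosSemidef := hB.posSemidef.mul_mul_conjTranspose_same _
  have hBC : B = C * E * Cᴴ := by
    rw [hE, conjTranspose_nonsing_inv, Matrix.mul_assoc C⁻¹, mul_nonsing_inv_cancel_left _ _ hCd,
      nonsing_inv_mul_cancel_right _ _ hCHd]
  let b : Fin n → ℝ := fun i => (E i i).re
  have hb_nonneg (i : Fin n) : 0 ≤ b i := (Complex.le_def.mp hE_psd.diag_nonneg).1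
  have hEb (i : Fin n) : E i i = b i :=
    Complex.ext rfl (Complex.le_def.mp (hE_psd.diag_nonneg (i := i))).2.symm
  have hWC' : W = C * 1 * Cᴴ := by rw [Matrix.mul_one, hWC]
  let p : Fin n := ⟨0, by omega⟩
  let r : Fin n := ⟨1, by omega⟩
  let q : Fin n := ⟨n - 1, by omega⟩
  have hpq : p ≠ q := by simp only [p, q, ne_eq, Fin.mk.injEq]; omega
  have hpr : p ≠ r := by simp [p, r]
  have h₀ : mixedDisc n (fun _ => W) = (n.factorial : ℝ)⁻¹ * Complex.normSq C.det *
      (Matrix.of fun _ _ => 1).permanent :=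
    mixedDisc_congruence C _ (fun _ => 1) _ q (fun _ => hWC') (fun _ _ => isDiag_one) (by simp)
  have h₁ : mixedDisc n (blocks3 n 2 (n - 2) W A A) =
      (n.factorial : ℝ)⁻¹ * Complex.normSq C.det *
        (Matrix.of fun k j => if k = p then 1 else if k = r then 1 else a j).permanent := by
    refine mixedDisc_congruence C _ (fun k => if k = p then 1 else if k = r then 1 else D) _ q
      (fun k => ?_) (fun k _ => ?_) (fun k j => ?_)
    · simp only [blocks3, p, r, Fin.ext_iff]
      split_ifs <;> first | exact hWC' | exact hAC | omega
    · split_ifs <;> first | exact isDiag_one | exact isDiag_diagonal _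
    · simp only [of_apply]
      split_ifs <;> simp [hD]
  have h₂ : mixedDisc n (blocks3 n (n - 1) 1 W B B) =
      (n.factorial : ℝ)⁻¹ * Complex.normSq C.det *
        (Matrix.of fun k j => if k = q then b j else 1).permanent := by
    refine mixedDisc_congruence C _ (fun k => if k = q then E else 1) _ q
      (fun k => ?_) (fun k hk => ?_) (fun k j => ?_)
    · simp only [blocks3, q, Fin.ext_iff]
      split_ifs <;> first | exact hWC' | exact hBC | omega
    · simp [hk, isDiag_one]
    · simp only [of_apply]
      split_ifs <;> simp [hEb]
  have h₃ : mixedDisc n (blocks3 n 1 (n - 2) W A B) =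
      (n.factorial : ℝ)⁻¹ * Complex.normSq C.det *
        (Matrix.of fun k j => if k = p then 1 else if k = q then b j else a j).permanent := by
    refine mixedDisc_congruence C _ (fun k => if k = p then 1 else if k = q then E else D) _ q
      (fun k => ?_) (fun k hk => ?_) (fun k j => ?_)
    · simp only [blocks3, p, q, Fin.ext_iff]
      split_ifs <;> first | exact hWC' | exact hBC | exact hAC | omega
    · simp only [hk, if_false]
      split_ifs <;> first | exact isDiag_one | exact isDiag_diagonal _
    · simp only [of_apply]
      split_ifs <;> simp [hD, hEb]
  have h_reorder :
      (Matrix.of fun k j => if k = p then 1 else if k = r then 1 else a j).permanent =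
        (Matrix.of fun k j => if k = p then 1 else if k = q then 1 else a j).permanent := by
    rw [← permanent_permute_cols (swap q r)]
    congr 1
    ext k j
    have e₁ : swap q r k = p ↔ k = p := by
      rw [swap_apply_eq_iff, swap_apply_of_ne_of_ne hpq hpr]
    have e₂ : swap q r k = r ↔ k = q := by
      rw [swap_apply_eq_iff, swap_apply_right]
    simp [e₁, e₂]
  have h_ones : (Matrix.of fun _ _ => 1 : Matrix (Fin n) (Fin n) ℝ).permanent = n.factorial := by
    simp [permanent, Fintype.card_perm]
  have h_single : (Matrix.of fun k j => if k = q then b j else 1).permanent =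
      ∑ σ : Perm (Fin n), b (σ q) := by
    rw [← permanent_transpose]
    simp [permanent]
  have h_card := card_mul_sum_perm_apply b q
  rw [Fintype.card_fin] at h_card
  have h_main := two_mul_permanent_le a b ha hb_nonneg hpq
  rw [h₀, h₁, h₂, h₃, h_reorder, h_ones, h_single]
  set c := (n.factorial : ℝ)⁻¹ * Complex.normSq C.det
  set T₁ := (Matrix.of fun k j => if k = p then 1 else if k = q then 1 else a j).permanent
  set T₃ := (Matrix.of fun k j => if k = p then 1 else if k = q then b j else a j).permanent
  set T₂ := ∑ σ : Perm (Fin n), b (σ q)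
  have hn' : (2 : ℝ) ≤ n := by exact_mod_cast hn
  have hT₁ : 0 ≤ T₁ := sum_nonneg fun σ _ => prod_nonneg fun k _ => by
    simp only [of_apply]
    split_ifs <;> first | exact zero_le_one | exact ha _
  have hT₂ : 0 ≤ T₂ := sum_nonneg fun σ _ => hb_nonneg _
  have h_le : n.factorial * T₃ ≤ (n - 1) * T₁ * T₂ := by
    have h_fac : (n.factorial : ℝ) * (2 * T₃) ≤ T₁ * (n * T₂) := by
      rw [h_card, mul_left_comm T₁]
      exact mul_le_mul_of_nonneg_left h_main (Nat.cast_nonneg _)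
    nlinarith [mul_nonneg (mul_nonneg hT₁ hT₂) (sub_nonneg.mpr hn')]
  calc c * n.factorial * (c * T₃) = c ^ 2 * (n.factorial * T₃) := by ring
    _ ≤ c ^ 2 * ((n - 1) * T₁ * T₂) := mul_le_mul_of_nonneg_left h_le (sq_nonneg c)
    _ = (n - 1) * (c * T₁) * (c * T₂) := by ring
end
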